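/- arXiv:1802.02667 — 2 statements merged into one kernel-verified Lean document; each statement's English description precedes it below -/
import Mathlib

section
/- Let χ²(n) be a chi-squared random variable with n degrees of freedom, and let a ≥ 0, b > 0 be constants. Then log₂(a + b·n) − 2·log₂(e)/n + log₂(1 + 1/n) ≤ E[log₂(a + b·χ²(n))] ≤ log₂(a + b·n). -/
open MeasureTheory Real Set

noncomputable def wt (s x : ℝ) : ℝ := x ^ (s - 1) * Real.exp (-x / 2)

lemma wt_nonneg (s x : ℝ) (hx : 0 < x) : 0 ≤ wt s x := by unfold wt; positivity

lemma wt_meas (s : ℝ) : Measurable (wt s) := by unfold wt; fun_prop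

lemma wt_succ (s x : ℝ) (hx : 0 < x) : wt (s + 1) x = x * wt s x := by
  unfold wt
  rw [show s + 1 - 1 = (s - 1) + 1 by ring, rpow_add_one hx.ne']; ring

lemma wt_int (s : ℝ) (hs : 0 < s) : IntegrableOn (wt s) (Ioi 0) := by
  have h := integrableOn_rpow_mul_exp_neg_mul_rpow (p := 1) (s := s - 1) (b := 1/2)
    (by linarith) one_pos (by norm_num)
  refine h.congr_fun (fun x _ => ?_) measurableSet_Ioi
  simp only [wt, rpow_one]; congr 2; ring

noncomputable def G (s : ℝ) : ℝ := ∫ x in Ioi (0:ℝ), wt s x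

lemma G_eq (s : ℝ) (hs : 0 < s) : G s = 2 ^ s * Real.Gamma s := by
  have h := Real.integral_rpow_mul_exp_neg_mul_Ioi hs (r := 1/2) (by norm_num)
  simp only [one_div_one_div] at h
  rw [← h]; unfold G wt
  refine setIntegral_congr_fun measurableSet_Ioi fun x _ => ?_
  congr 2; ring

lemma G_pos (s : ℝ) (hs : 0 < s) : 0 < G s := by
  rw [G_eq s hs]; have := Real.Gamma_pos_of_pos hs; positivity

lemma G_succ (s : ℝ) (hs : 0 < s) : G (s + 1) = 2 * s * G s := by
  rw [G_eq s hs, G_eq _ (by linarith), Real.Gamma_add_one hs.ne', rpow_add_one two_ne_zero]; ring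

lemma log_int (s : ℝ) (hs : 0 < s) : IntegrableOn (fun x => log x * wt s x) (Ioi 0) := by
  have h1 := (wt_int (s + s/2) (by linarith)).const_mul (1/(s/2))
  have h2 := (wt_int (s - s/2) (by linarith)).const_mul (1/(s/2))
  refine (h1.add h2).mono' ((measurable_log.mul (wt_meas s)).aestronglyMeasurable) ?_
  filter_upwards [ae_restrict_mem measurableSet_Ioi] with x hx
  have hx : 0 < x := hx
  have hw := wt_nonneg s x hx
  have e1 : wt (s + s/2) x = x ^ (s/2) * wt s x := by
    unfold wt; rw [show s + s/2 - 1 = s/2 + (s - 1) by ring, rpow_add hx]; ring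
  have e2 : wt (s - s/2) x = (x⁻¹) ^ (s/2) * wt s x := by
    unfold wt
    rw [show s - s/2 - 1 = -(s/2) + (s - 1) by ring, rpow_add hx, rpow_neg hx.le, inv_rpow hx.le]
    ring
  have l1 := log_le_rpow_div hx.le (ε := s/2) (by linarith)
  have l2 := log_le_rpow_div (inv_pos.2 hx).le (ε := s/2) (by linarith)
  rw [log_inv] at l2
  have p1 : 0 ≤ x ^ (s/2) / (s/2) := by positivity
  have p2 : 0 ≤ (x⁻¹) ^ (s/2) / (s/2) := by positivity
  rw [norm_mul, norm_of_nonneg hw, Real.norm_eq_abs]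
  simp only [Pi.add_apply]
  rw [e1, e2]
  have : |log x| ≤ x ^ (s/2) / (s/2) + (x⁻¹) ^ (s/2) / (s/2) := abs_le.2 ⟨by linarith, by linarith⟩
  calc _ ≤ (x ^ (s/2) / (s/2) + (x⁻¹) ^ (s/2) / (s/2)) * wt s x := by gcongr
    _ = _ := by ring

noncomputable def H (s : ℝ) : ℝ := ∫ x in Ioi (0:ℝ), log x * wt s x

lemma H_succ (s : ℝ) (hs : 0 < s) : H (s + 1) = 2 * (s * H s + G s) := by
  have i1 := log_int s hs
  have i2 := log_int (s+1) (by linarith)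
  have i3 := wt_int s hs
  have hF : ∀ x ∈ Ioi (0:ℝ), HasDerivAt (fun x => log x * wt (s+1) x)
      (s * (log x * wt s x) + wt s x - (1/2) * (log x * wt (s+1) x)) x := by
    intro x hx
    have hx : 0 < x := hx
    have d1 := hasDerivAt_log hx.ne'
    have d2 := Real.hasDerivAt_rpow_const (x := x) (p := s + 1 - 1) (Or.inl hx.ne')
    have d3 : HasDerivAt (fun x : ℝ => Real.exp (-x/2)) (Real.exp (-x/2) * (-1/2)) x :=
      (((hasDerivAt_id x).neg).div_const 2).exp
    have := d1.mul (d2.mul d3)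
    refine this.congr_deriv ?_
    simp only [Pi.mul_apply]
    rw [wt_succ s x hx]
    unfold wt
    rw [show s + 1 - 1 = (s - 1) + 1 by ring, rpow_add_one hx.ne', add_sub_cancel_right]
    field_simp
    ring
  have iF : IntegrableOn (fun x => s * (log x * wt s x) + wt s x - (1/2) * (log x * wt (s+1) x)) (Ioi 0) :=
    ((i1.const_mul s).add i3).sub (i2.const_mul _)
  have t0 : Filter.Tendsto (fun x => log x * wt (s+1) x) (nhdsWithin 0 (Ioi 0)) (nhds 0) := by
    have h1 := tendsto_log_mul_rpow_nhdsGT_zero hs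
    have h2 : Filter.Tendsto (fun x : ℝ => Real.exp (-x/2)) (nhdsWithin 0 (Ioi 0)) (nhds 1) := by
      have : Continuous (fun x : ℝ => Real.exp (-x/2)) := by fun_prop
      have := this.tendsto 0
      simp only [neg_zero, zero_div, Real.exp_zero] at this
      exact this.mono_left nhdsWithin_le_nhds
    have := h1.mul h2
    simp only [zero_mul] at this
    refine this.congr fun x => ?_
    unfold wt; rw [add_sub_cancel_right, mul_assoc]
  have t1 := tendsto_zero_of_hasDerivAt_of_integrableOn_Ioi hF iF i2
  have hc : ContinuousWithinAt (fun x => log x * wt (s+1) x) (Ici 0) 0 := by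
    rw [← continuousWithinAt_Ioi_iff_Ici]
    simpa [ContinuousWithinAt] using t0
  have := integral_Ioi_of_hasDerivAt_of_tendsto hc hF iF t1
  simp only [log_zero, zero_mul, sub_zero] at this
  have e : ∫ x in Ioi (0:ℝ), (s * (log x * wt s x) + wt s x - (1/2) * (log x * wt (s+1) x))
      = s * H s + G s - (1/2) * H (s+1) := by
    have i5 : IntegrableOn (fun x => s * (log x * wt s x) + wt s x) (Ioi 0) :=
      (i1.const_mul s).add i3
    rw [integral_sub i5 (i2.const_mul _), integral_add (i1.const_mul s) i3,
      integral_const_mul, integral_const_mul]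
    rfl
  linarith

lemma H_lb (s : ℝ) (hs : 0 < s) : log (2 * s) * G (s + 1) ≤ H (s + 1) := by
  have i2 := log_int (s+1) (by linarith)
  have i3 := wt_int s hs
  have i4 := wt_int (s + 1) (by linarith)
  have : ∫ x in Ioi (0:ℝ), ((log (2*s) + 1) * wt (s+1) x - (2 * s) * wt s x) ≤ H (s+1) := by
    refine setIntegral_mono_on ((i4.const_mul _).sub (i3.const_mul _)) i2 measurableSet_Ioi ?_
    intro x hx
    have hx : 0 < x := hx
    have h := one_sub_inv_le_log_of_pos (x := x / (2*s)) (by positivity)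
    rw [log_div hx.ne' (by positivity), inv_div] at h
    have hw := wt_nonneg (s+1) x hx
    have e : (2 * s) * wt s x = (2*s/x) * wt (s+1) x := by
      rw [wt_succ s x hx]; field_simp
    rw [e]
    nlinarith
  rw [integral_sub (i4.const_mul _) (i3.const_mul _), integral_const_mul, integral_const_mul] at this
  change (log (2*s) + 1) * G (s+1) - 2 * s * G s ≤ _ at this
  have := G_succ s hs
  linarith

noncomputable def M (s : ℝ) : ℝ := H s / G s

lemma M_succ (s : ℝ) (hs : 0 < s) : M (s + 1) = M s + 1 / s := by
  unfold M
  have := G_pos s hs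
  rw [H_succ s hs, G_succ s hs]; field_simp

lemma M_lb0 (s : ℝ) (hs : 0 < s) : log (2 * s) ≤ M (s + 1) := by
  unfold M
  rw [le_div_iff₀ (G_pos _ (by linarith))]; exact H_lb s hs

lemma M_step (s : ℝ) (hs : 0 < s) :
    M (s + 1 + 1) - log (2 * (s + 1) + 1) ≤ M (s + 1) - log (2 * s + 1) := by
  rw [M_succ (s+1) (by linarith)]
  have h := le_log_one_add_of_nonneg (x := 2 / (2 * s + 1)) (by positivity)
  rw [show 1 + 2 / (2 * s + 1) = (2 * (s + 1) + 1) / (2 * s + 1) by field_simp; ring,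
    log_div (by positivity) (by positivity),
    show 2 * (2 / (2 * s + 1)) / (2 / (2 * s + 1) + 2) = 1 / (s + 1) by field_simp; ring] at h
  linarith

lemma M_iter (s : ℝ) (hs : 0 < s) (k : ℕ) :
    M (s + k + 1) - log (2 * (s + k) + 1) ≤ M (s + 1) - log (2 * s + 1) := by
  induction k with
  | zero => simp
  | succ k ih =>
    have := M_step (s + k) (by positivity)
    push_cast
    rw [← add_assoc]
    linarith

lemma M_lb1 (s : ℝ) (hs : 0 < s) : log (2 * s + 1) ≤ M (s + 1) := by
  have key : ∀ k : ℕ, -(1 / ((k:ℝ) + 1)) ≤ M (s + 1) - log (2 * s + 1) + 0 := by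
    intro k
    have h1 := M_iter s hs (k+1)
    have h2 := M_lb0 (s + (k+1 : ℕ)) (by positivity)
    set t := s + ((k+1 : ℕ) : ℝ) with ht
    have htk : (k:ℝ) + 1 ≤ t := by push_cast at ht; linarith
    have htp : 0 < t := by positivity
    have h3 := log_le_sub_one_of_pos (x := (2*t+1)/(2*t)) (by positivity)
    rw [log_div (by positivity) (by positivity)] at h3
    have h4 : (2*t+1)/(2*t) - 1 ≤ 1 / ((k:ℝ)+1) := by
      rw [show (2*t+1)/(2*t) - 1 = 1/(2*t) by field_simp; ring]
      apply one_div_le_one_div_of_le <;> [positivity; linarith]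
    linarith
  have := (tendsto_one_div_add_atTop_nhds_zero_nat (𝕜 := ℝ)).neg
  have := le_of_tendsto' this key
  linarith

lemma M_lb (s : ℝ) (hs : 0 < s) : log (2 * s + 1) - 1 / s ≤ M s := by
  have := M_lb1 s hs
  rw [M_succ s hs] at this; linarith

lemma logab_int (s : ℝ) (hs : 0 < s) (a b : ℝ) (ha : 0 ≤ a) (hb : 0 < b) :
    IntegrableOn (fun x => log (a + b * x) * wt s x) (Ioi 0) := by
  have i1 := (log_int s hs).add ((wt_int s hs).const_mul (log b))
  have i2 := ((wt_int s hs).const_mul a).add ((wt_int (s+1) (by linarith)).const_mul b)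
  have hm : Measurable (fun x => log (a + b * x) * wt s x) :=
    (Measurable.log (by fun_prop)).mul (wt_meas s)
  refine integrable_of_le_of_le hm.aestronglyMeasurable ?_ ?_ i1 i2
  · filter_upwards [ae_restrict_mem measurableSet_Ioi] with x hx
    have hx : 0 < x := hx
    have hw := wt_nonneg s x hx
    simp only [Pi.add_apply]
    have : log (b * x) ≤ log (a + b * x) := log_le_log (by positivity) (by linarith)
    rw [log_mul hb.ne' hx.ne'] at this
    nlinarith
  · filter_upwards [ae_restrict_mem measurableSet_Ioi] with x hx
    have hx : 0 < x := hx
    have hw := wt_nonneg s x hx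
    simp only [Pi.add_apply]
    have := log_le_sub_one_of_pos (x := a + b * x) (by positivity)
    rw [wt_succ s x hx]
    nlinarith

lemma ub (s : ℝ) (hs : 0 < s) (a b : ℝ) (ha : 0 ≤ a) (hb : 0 < b) :
    ∫ x in Ioi (0:ℝ), log (a + b * x) * wt s x ≤ log (a + b * (2 * s)) * G s := by
  have i3 := wt_int s hs
  have i4 := wt_int (s + 1) (by linarith)
  set c := a + b * (2 * s) with hc
  have hcp : 0 < c := by positivity
  have : ∫ x in Ioi (0:ℝ), log (a + b * x) * wt s x ≤
      ∫ x in Ioi (0:ℝ), ((log c - 1 + a / c) * wt s x + (b / c) * wt (s+1) x) := by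
    refine setIntegral_mono_on (logab_int s hs a b ha hb) ((i3.const_mul _).add (i4.const_mul _)) measurableSet_Ioi ?_
    intro x hx
    have hx : 0 < x := hx
    have hw := wt_nonneg s x hx
    have h := log_le_sub_one_of_pos (x := (a + b * x) / c) (by positivity)
    rw [log_div (by positivity) hcp.ne'] at h
    rw [wt_succ s x hx]
    calc _ ≤ (log c + ((a + b * x) / c - 1)) * wt s x := by gcongr; linarith
      _ = _ := by ring
  rw [integral_add (i3.const_mul _) (i4.const_mul _), integral_const_mul, integral_const_mul] at this
  change _ ≤ (log c - 1 + a / c) * G s + b / c * G (s+1) at this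
  rw [G_succ s hs] at this
  refine this.trans (le_of_eq ?_)
  have : a / c + b / c * (2 * s) = 1 := by rw [hc] at *; field_simp
  linear_combination (G s) * this

lemma lb (s : ℝ) (hs : 0 < s) (a b : ℝ) (ha : 0 ≤ a) (hb : 0 < b) :
    (log (a + b * (2 * s)) + (M s - log (2 * s))) * G s ≤
      ∫ x in Ioi (0:ℝ), log (a + b * x) * wt s x := by
  have i1 := log_int s hs
  have i3 := wt_int s hs
  have hG := G_pos s hs
  have hM : M s ≤ log (2 * s) := by
    have := ub s hs 0 1 le_rfl one_pos
    simp only [zero_add, one_mul] at this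
    exact (div_le_iff₀ hG).2 this
  have hMG : M s * G s = H s := div_mul_cancel₀ _ hG.ne'
  set c := a + b * (2 * s) with hc
  have hcp : 0 < c := by positivity
  set m := b * (2 * s) / c with hm
  have hm0 : 0 ≤ m := by positivity
  have hm1 : m ≤ 1 := by rw [hm, div_le_one hcp]; linarith
  have : ∫ x in Ioi (0:ℝ), ((log c - m * log (2 * s)) * wt s x + m * (log x * wt s x)) ≤
      ∫ x in Ioi (0:ℝ), log (a + b * x) * wt s x := by
    refine setIntegral_mono_on ((i3.const_mul _).add (i1.const_mul _)) (logab_int s hs a b ha hb) measurableSet_Ioi ?_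
    intro x hx
    have hx : 0 < x := hx
    have hw := wt_nonneg s x hx
    have h := strictConcaveOn_log_Ioi.concaveOn.2
      (mem_Ioi.2 one_pos) (mem_Ioi.2 (show 0 < x / (2 * s) by positivity)) (show 0 ≤ 1 - m by linarith) hm0 (by ring)
    have e : (1 - m) * 1 + m * (x / (2 * s)) = (a + b * x) / c := by
      rw [hm]; field_simp; rw [hc]; ring
    simp only [smul_eq_mul] at h
    rw [e, log_one, log_div (by positivity) hcp.ne', log_div (by positivity) (by positivity)] at h
    calc _ = (log c + m * (log x - log (2 * s))) * wt s x := by ring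
      _ ≤ _ := by gcongr; linarith
  rw [integral_add (i3.const_mul _) (i1.const_mul _), integral_const_mul, integral_const_mul] at this
  change (log c - m * log (2*s)) * G s + m * H s ≤ _ at this
  refine le_trans ?_ this
  rw [← hMG]
  have : M s - log (2 * s) ≤ m * (M s - log (2 * s)) := by nlinarith
  nlinarith

theorem chiSquared_log_jensen_gap (n : ℕ) (hn : 1 ≤ n) (a b : ℝ) (ha : 0 ≤ a) (hb : 0 < b) :
    Real.logb 2 (a + b * n) - 2 * Real.logb 2 (Real.exp 1) / n + Real.logb 2 (1 + 1 / n)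
        ≤ ∫ x in Set.Ioi (0 : ℝ), Real.logb 2 (a + b * x) *
            (x ^ ((n : ℝ) / 2 - 1) * Real.exp (-x / 2)
              / ((2 : ℝ) ^ ((n : ℝ) / 2) * Real.Gamma ((n : ℝ) / 2)))
    ∧ ∫ x in Set.Ioi (0 : ℝ), Real.logb 2 (a + b * x) *
            (x ^ ((n : ℝ) / 2 - 1) * Real.exp (-x / 2)
              / ((2 : ℝ) ^ ((n : ℝ) / 2) * Real.Gamma ((n : ℝ) / 2)))
        ≤ Real.logb 2 (a + b * n) := by
  have hn0 : (0:ℝ) < n := by exact_mod_cast hn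
  have hs : (0:ℝ) < n / 2 := by positivity
  have hG := G_pos _ hs
  have hl : 0 < log 2 := log_pos one_lt_two
  have e : ∫ x in Set.Ioi (0 : ℝ), Real.logb 2 (a + b * x) *
            (x ^ ((n : ℝ) / 2 - 1) * Real.exp (-x / 2)
              / ((2 : ℝ) ^ ((n : ℝ) / 2) * Real.Gamma ((n : ℝ) / 2)))
      = (∫ x in Ioi (0:ℝ), log (a + b * x) * wt (n/2) x) / G (n/2) / log 2 := by
    rw [← G_eq _ hs, ← integral_div, ← integral_div]
    refine setIntegral_congr_fun measurableSet_Ioi fun x _ => ?_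
    simp only [logb, wt]
    ring
  rw [e]
  have hu := ub _ hs a b ha hb
  have hlo := lb _ hs a b ha hb
  have hM := M_lb _ hs
  have e2 : 2 * ((n:ℝ)/2) = n := by ring
  rw [e2] at hu hlo hM
  rw [← div_le_iff₀ hG] at hu
  rw [← le_div_iff₀ hG] at hlo
  constructor
  · rw [le_div_iff₀ hl]
    refine le_trans ?_ hlo
    have e3 : 1 + 1 / (n:ℝ) = (n + 1) / n := by field_simp
    simp only [logb, log_exp]
    rw [e3, log_div (by positivity) hn0.ne']
    have e4 : (log (a + b * n) / log 2 - 2 * (1 / log 2) / n + (log (n + 1) - log n) / log 2) * log 2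
        = log (a + b * n) + (log (n + 1) - 1 / (n / 2) - log n) := by field_simp; ring
    rw [e4]; linarith
  · unfold logb
    gcongr
end

section
/- Consider the bilinear optimization problem: maximize over 0 ≤ γ_c ≤ γ_{rd1} and 0 ≤ p ≤ 1 the quantity min{ p·((T−1)(γ_{rd2} − γ_{rd1}) − γ_c) + (T−1)γ_{rd1}, (T−1)γ_{sr2} + p·((T−2)γ_c − (T−1)γ_{rd1}) + (T−1)γ_{rd1} }, under T ≥ 2, γ_{rd2} ≥ γ_{rd1} ≥ 0, γ_{rd2} ≥ γ_{sr2} ≥ 0, and (T−2)γ_{rd2} − (T−1)γ_{rd1} > 0. If additionally γ_{rd2} > γ_{sr2} + γ_{rd1}, then the optimal value equals (T−1)(γ_{sr2} + γ_{rd1}) − γ_{sr2}γ_{rd1}/(γ_{rd2} − γ_{rd1}), attained at γ_c = γ_{rd1}, p = γ_{sr2}/(γ_{rd2} − γ_{rd1}). -/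
/-- Case 2.1 of the bilinear gDoF optimization for the noncoherent diamond network.
Under T ≥ 2, γrd2 ≥ γrd1 ≥ 0, γrd2 ≥ γsr2 ≥ 0, (T−2)γrd2 − (T−1)γrd1 > 0 and
γrd2 > γsr2 + γrd1, the optimal value of
  max_{0≤γc≤γrd1, 0≤p≤1} min{ p((T−1)(γrd2−γrd1)−γc) + (T−1)γrd1 ,
    (T−1)γsr2 + p((T−2)γc−(T−1)γrd1) + (T−1)γrd1 }
is (T−1)(γsr2+γrd1) − γsr2·γrd1/(γrd2−γrd1), attained at γc = γrd1,
p = γsr2/(γrd2−γrd1). -/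
theorem bilinear_opt_case2_1 (T : ℕ) (hT : 2 ≤ T) (γsr2 γrd1 γrd2 : ℝ)
    (h1 : 0 ≤ γrd1) (h2 : γrd1 ≤ γrd2) (h3 : 0 ≤ γsr2) (h4 : γsr2 ≤ γrd2)
    (hcase : 0 < ((T : ℝ) - 2) * γrd2 - ((T : ℝ) - 1) * γrd1)
    (hsub : γsr2 + γrd1 < γrd2) :
    IsGreatest {v : ℝ | ∃ γc p : ℝ, 0 ≤ γc ∧ γc ≤ γrd1 ∧ 0 ≤ p ∧ p ≤ 1 ∧
        v = min (p * (((T : ℝ) - 1) * (γrd2 - γrd1) - γc) + ((T : ℝ) - 1) * γrd1)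
                (((T : ℝ) - 1) * γsr2 + p * (((T : ℝ) - 2) * γc - ((T : ℝ) - 1) * γrd1)
                  + ((T : ℝ) - 1) * γrd1)}
      (((T : ℝ) - 1) * (γsr2 + γrd1) - γsr2 * γrd1 / (γrd2 - γrd1))
    ∧ min ((γsr2 / (γrd2 - γrd1)) * (((T : ℝ) - 1) * (γrd2 - γrd1) - γrd1)
            + ((T : ℝ) - 1) * γrd1)
          (((T : ℝ) - 1) * γsr2
            + (γsr2 / (γrd2 - γrd1)) * (((T : ℝ) - 2) * γrd1 - ((T : ℝ) - 1) * γrd1)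
            + ((T : ℝ) - 1) * γrd1)
        = ((T : ℝ) - 1) * (γsr2 + γrd1) - γsr2 * γrd1 / (γrd2 - γrd1) := by
  have hd : 0 < γrd2 - γrd1 := by linarith
  have ht : (2 : ℝ) ≤ (T : ℝ) := by exact_mod_cast hT
  obtain ⟨q, hq⟩ : ∃ q, q = γsr2 / (γrd2 - γrd1) := ⟨_, rfl⟩
  have hs : γsr2 = q * (γrd2 - γrd1) := by rw [hq]; field_simp
  have hq0 : 0 ≤ q := by rw [hq]; positivity
  have hq1 : q ≤ 1 := by rw [hq, div_le_one hd]; linarith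
  have hv : γsr2 * γrd1 / (γrd2 - γrd1) = q * γrd1 := by rw [hq]; ring
  have key : min (q * (((T : ℝ) - 1) * (γrd2 - γrd1) - γrd1)
            + ((T : ℝ) - 1) * γrd1)
          (((T : ℝ) - 1) * γsr2
            + q * (((T : ℝ) - 2) * γrd1 - ((T : ℝ) - 1) * γrd1)
            + ((T : ℝ) - 1) * γrd1)
        = ((T : ℝ) - 1) * (γsr2 + γrd1) - q * γrd1 := by
    rw [hs, min_eq_left (le_of_eq (by ring))]
    ring
  rw [hv, ← hq]
  refine ⟨⟨⟨γrd1, q, h1, le_rfl, hq0, hq1, key.symm⟩, ?_⟩, key⟩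
  rintro v ⟨c, p, hc0, hc1, hp0, hp1, rfl⟩
  rcases le_total p q with h | h
  · by_contra hlt
    rw [not_le, lt_min_iff] at hlt
    obtain ⟨a, b⟩ := hlt
    have e1 := mul_le_mul_of_nonneg_left a.le (by linarith : (0 : ℝ) ≤ (T : ℝ) - 2)
    have e2 := mul_nonneg (sub_nonneg.2 h) hcase.le
    rw [hs] at e1 b
    nlinarith [e1, e2, b]
  · refine (min_le_right _ _).trans ?_
    have e1 := mul_nonneg hp0 (mul_nonneg (by linarith : (0 : ℝ) ≤ (T : ℝ) - 2) (sub_nonneg.2 hc1))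
    have e2 := mul_nonneg (sub_nonneg.2 h) h1
    nlinarith [e1, e2]
end
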